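/- Let s > 1, y > 0, and let u ∈ C^∞(I, H^s_+(𝕋)) be a solution of u̇ = X_{J^y}(u) on a time interval I. Then dH_{u(t)}/dt = [B_{u(t)}^y, H_{u(t)}] and dK_{u(t)}/dt = [C_{u(t)}^y, K_{u(t)}], where B_u^y := −iF_u^y and C_u^y := −iG_u^y, with G_u^y(h) := −y w^y Π(conj(w^y) h) + y² (H_u w^y) Π(conj(H_u w^y) h) and F_u^y(h) := G_u^y(h) − y² (h | H_u w^y) H_u w^y. -/

import Mathlib

open scoped BigOperators ComplexConjugate

noncomputable section

/-- The Hardy space `L²₊(𝕋)` of the circle, modeled by the Hilbert space `ℓ²(ℕ, ℂ)` of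
sequences of nonnegative Fourier (= Taylor) coefficients. -/
abbrev Hardy : Type := lp (fun _ : ℕ => ℂ) 2

/-- The Fourier coefficients of an element of the Hardy space. -/
def coeffs (f : Hardy) : ℕ → ℂ := fun n => f n

/-- Membership in the Sobolev space `Hˢ₊(𝕋)`, expressed on Fourier coefficients. -/
def InHs (s : ℝ) (u : ℕ → ℂ) : Prop :=
  Summable fun k : ℕ => ((1 : ℝ) + (k : ℝ) ^ 2) ^ s * ‖u k‖ ^ 2

/-- The `Hˢ` norm, expressed on Fourier coefficients. -/
def hsNorm (s : ℝ) (u : ℕ → ℂ) : ℝ :=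
  Real.sqrt (∑' k : ℕ, ((1 : ℝ) + (k : ℝ) ^ 2) ^ s * ‖u k‖ ^ 2)

/-- Membership in the Wiener algebra `W`. -/
def InW (u : ℕ → ℂ) : Prop := Summable fun k : ℕ => ‖u k‖

/-- The Wiener norm `‖u‖_W = Σ |û(k)|`. -/
def wienerNorm (u : ℕ → ℂ) : ℝ := ∑' k : ℕ, ‖u k‖

/-- The `L²` norm, expressed on Fourier coefficients. -/
def l2Norm (u : ℕ → ℂ) : ℝ := Real.sqrt (∑' k : ℕ, ‖u k‖ ^ 2)

/-- The Hankel operator `H_u(h) = Π(u h̄)`, expressed on Fourier coefficients: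
`(H_u h)^(n) = Σ_p û(n+p) conj(ĥ(p))`. -/
def hankel (u h : ℕ → ℂ) : ℕ → ℂ := fun n => ∑' p : ℕ, u (n + p) * conj (h p)

/-- The shifted Hankel operator `K_u = S* H_u`. -/
def shiftedHankel (u h : ℕ → ℂ) : ℕ → ℂ := fun n => hankel u h (n + 1)

/-- Fourier coefficients of the pointwise product `fg` of two holomorphic (Hardy class)
functions: the Cauchy product. -/
def mulCoeff (f g : ℕ → ℂ) : ℕ → ℂ := fun n => ∑ p ∈ Finset.range (n + 1), f p * g (n - p)

/-- Fourier coefficients of `T_{a b̄}(h) = Π(a b̄ h)` for `a, b, h` in the Hardy class. -/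
def toeplitzAB (a b h : ℕ → ℂ) : ℕ → ℂ :=
  fun n => ∑' q : ℕ, conj (b q) * mulCoeff a h (n + q)

/-- Fourier coefficients of `T_{ā}(h) = Π(ā h)` for `a, h` in the Hardy class. -/
def toeplitzConj (a h : ℕ → ℂ) : ℕ → ℂ := fun n => ∑' q : ℕ, conj (a q) * h (n + q)

/-- The Szegő nonlinearity `Π(|u|²u) = T_{u ū}(u)`. -/
def szegoNL (u : ℕ → ℂ) : ℕ → ℂ := toeplitzAB u u u

/-- The operator `B_u = (i/2) H_u² - i T_{|u|²}` of the Lax pair. -/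
def laxB (u h : ℕ → ℂ) : ℕ → ℂ := fun n =>
  Complex.I / 2 * hankel u (hankel u h) n - Complex.I * toeplitzAB u u h n

/-- The operator `C_u = (i/2) K_u² - i T_{|u|²}` of the Lax pair. -/
def laxC (u h : ℕ → ℂ) : ℕ → ℂ := fun n =>
  Complex.I / 2 * shiftedHankel u (shiftedHankel u h) n - Complex.I * toeplitzAB u u h n

/-- `u : ℝ → L²₊` is a (smooth in time, `Hˢ`-valued) solution of the cubic Szegő equation
`i ∂_t u = Π(|u|²u)`. -/
def IsSzegoSolution (s : ℝ) (u : ℝ → Hardy) : Prop :=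
  (∀ t, InHs s (coeffs (u t))) ∧ ContDiff ℝ (⊤ : ℕ∞) u ∧
    ∀ t n, HasDerivAt (fun τ : ℝ => coeffs (u τ) n) (-Complex.I * szegoNL (coeffs (u t)) n) t

/-- The Hankel operator with symbol `u` (composed with complex conjugation, which does not
change its range), as a linear map on finitely supported sequences. -/
def hankelLM (u : ℕ → ℂ) : (ℕ →₀ ℂ) →ₗ[ℂ] (ℕ → ℂ) :=
  Finsupp.lsum ℂ fun p => LinearMap.toSpanSingleton ℂ (ℕ → ℂ) fun n => u (n + p)

/-- The rank of the Hankel operator `H_u`. -/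
def hankelRank (u : ℕ → ℂ) : ℕ := Module.finrank ℂ (LinearMap.range (hankelLM u))

/-- The finite rank manifold `𝒱(d)`: `u` with `rk H_u = [(d+1)/2]` and `rk K_u = [d/2]`
(recall `K_u = H_{S*u}`). -/
def InV (d : ℕ) (u : ℕ → ℂ) : Prop :=
  InHs (1 / 2) u ∧ FiniteDimensional ℂ (LinearMap.range (hankelLM u)) ∧
    hankelRank u = (d + 1) / 2 ∧ hankelRank (fun n => u (n + 1)) = d / 2

/-- `w = w^y = (I + y H_u²)⁻¹(1)`, characterized by `(I + y H_u²) w = 1`. -/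
def IsResolventOne (y : ℝ) (u w : ℕ → ℂ) : Prop :=
  Memℓp w 2 ∧ ∀ n, w n + (y : ℂ) * hankel u (hankel u w) n = if n = 0 then 1 else 0

/-- The Hamiltonian vector field `X_{J^y}(u) = 2iy w^y H_u(w^y)` (a pointwise product of two
Hardy class functions), expressed on Fourier coefficients; `w` stands for `w^y`. -/
def XJ (y : ℝ) (u w : ℕ → ℂ) : ℕ → ℂ :=
  fun n => 2 * Complex.I * (y : ℂ) * mulCoeff w (hankel u w) n

/-- The operator `G_u^y(h) = -y w^y Π(conj(w^y) h) + y² (H_u w^y) Π(conj(H_u w^y) h)`;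
`w` stands for `w^y`. -/
def Gop (y : ℝ) (u w h : ℕ → ℂ) : ℕ → ℂ := fun n =>
  -(y : ℂ) * mulCoeff w (toeplitzConj w h) n
    + (y : ℂ) ^ 2 * mulCoeff (hankel u w) (toeplitzConj (hankel u w) h) n

/-- The operator `F_u^y(h) = G_u^y(h) - y² (h | H_u w^y) H_u w^y`; `w` stands for `w^y`. -/
def Fop (y : ℝ) (u w h : ℕ → ℂ) : ℕ → ℂ := fun n =>
  Gop y u w h n - (y : ℂ) ^ 2 * (∑' p : ℕ, h p * conj (hankel u w p)) * hankel u w n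


/-- `u : ℝ → L²₊` is, on the time interval `I`, a (smooth, `Hˢ`-valued) solution of the Szegő
hierarchy equation `u̇ = X_{J^y}(u)`; `w t` denotes `w^y(t) = (I + y H_{u(t)}²)⁻¹(1)`. -/
def IsJySolutionOn (s y : ℝ) (I : Set ℝ) (u : ℝ → Hardy) (w : ℝ → ℕ → ℂ) : Prop :=
  (∀ t ∈ I, InHs s (coeffs (u t))) ∧ ContDiffOn ℝ (⊤ : ℕ∞) u I ∧
    (∀ t ∈ I, IsResolventOne y (coeffs (u t)) (w t)) ∧
    ∀ t ∈ I, ∀ n : ℕ,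
      HasDerivAt (fun τ : ℝ => coeffs (u τ) n) (XJ y (coeffs (u t)) (w t) n) t

theorem InW.comp_injective {a : ℕ → ℂ} (ha : InW a) {f : ℕ → ℕ} (hf : f.Injective) :
    InW fun n => a (f n) :=
  Summable.comp_injective (f := fun n => ‖a n‖) ha hf

theorem InW.tsum_comp_le {a : ℕ → ℂ} (ha : InW a) {f : ℕ → ℕ} (hf : f.Injective) :
    ∑' n, ‖a (f n)‖ ≤ wienerNorm a :=
  tsum_comp_le_tsum_of_inj ha (fun _ => norm_nonneg _) hf

/-- Boundedness of a sequence of coefficients. -/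
def IsBdd (h : ℕ → ℂ) : Prop := ∃ C, ∀ n, ‖h n‖ ≤ C

theorem IsBdd.conj {h : ℕ → ℂ} (hh : IsBdd h) : IsBdd fun n => conj (h n) :=
  hh.imp fun _ hC n => by simpa using hC n

theorem InW.conj {a : ℕ → ℂ} (ha : InW a) : InW fun n => conj (a n) := by
  simpa [InW] using ha

theorem InW.isBdd {a : ℕ → ℂ} (ha : InW a) : IsBdd a :=
  ⟨wienerNorm a, fun n => ha.le_tsum n fun _ _ => norm_nonneg _⟩

theorem isBdd_of_memlp {h : ℕ → ℂ} (hh : Memℓp h 2) : IsBdd h := by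
  obtain ⟨C, hC⟩ := (memℓp_infty_iff.1 (hh.of_exponent_ge le_top))
  exact ⟨C, fun n => hC ⟨n, rfl⟩⟩

theorem InW.summable_norm_mul {a h : ℕ → ℂ} (ha : InW a) (hh : IsBdd h) :
    Summable fun p => ‖a p * h p‖ := by
  obtain ⟨C, hC⟩ := hh
  refine Summable.of_nonneg_of_le (fun _ => norm_nonneg _) (fun p => ?_) (ha.mul_right C)
  rw [norm_mul]
  exact mul_le_mul_of_nonneg_left (hC p) (norm_nonneg _)

theorem InW.summable_mul {a h : ℕ → ℂ} (ha : InW a) (hh : IsBdd h) :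
    Summable fun p => a p * h p :=
  (ha.summable_norm_mul hh).of_norm

theorem InW.norm_tsum_mul_le {a h : ℕ → ℂ} (ha : InW a) {C : ℝ} (hC : ∀ n, ‖h n‖ ≤ C) :
    ‖∑' p, a p * h p‖ ≤ wienerNorm a * C := by
  rw [wienerNorm, ← tsum_mul_right]
  refine (norm_tsum_le_tsum_norm (ha.summable_norm_mul ⟨C, hC⟩)).trans ?_
  refine (ha.summable_norm_mul ⟨C, hC⟩).tsum_le_tsum (fun p => ?_) (ha.mul_right C)
  rw [norm_mul]
  exact mul_le_mul_of_nonneg_left (hC p) (norm_nonneg _)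

theorem summable_hankel {u h : ℕ → ℂ} (hu : InW u) (hh : IsBdd h) (n : ℕ) :
    Summable fun p => u (n + p) * conj (h p) :=
  (hu.comp_injective (add_right_injective n)).summable_mul hh.conj

theorem isBdd_toeplitzConj {a h : ℕ → ℂ} (ha : InW a) (hh : IsBdd h) :
    IsBdd (toeplitzConj a h) := by
  obtain ⟨C, hC⟩ := hh
  exact ⟨_, fun n => ha.conj.norm_tsum_mul_le fun q => hC (n + q)⟩

theorem isBdd_mulCoeff {a h : ℕ → ℂ} (ha : InW a) (hh : IsBdd h) : IsBdd (mulCoeff a h) := by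
  obtain ⟨C, hC⟩ := hh
  have hC' : 0 ≤ C := (norm_nonneg _).trans (hC 0)
  refine ⟨wienerNorm a * C, fun n => ?_⟩
  refine (norm_sum_le _ _).trans ?_
  calc ∑ p ∈ Finset.range (n + 1), ‖a p * h (n - p)‖
      ≤ ∑ p ∈ Finset.range (n + 1), ‖a p‖ * C := Finset.sum_le_sum fun p _ => by
        rw [norm_mul]; exact mul_le_mul_of_nonneg_left (hC _) (norm_nonneg _)
    _ = (∑ p ∈ Finset.range (n + 1), ‖a p‖) * C := by rw [Finset.sum_mul]
    _ ≤ wienerNorm a * C :=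
        mul_le_mul_of_nonneg_right (ha.sum_le_tsum _ fun _ _ => norm_nonneg _) hC'

theorem mulCoeff_comm (f g : ℕ → ℂ) : mulCoeff f g = mulCoeff g f := by
  funext n
  unfold mulCoeff
  rw [← Finset.sum_range_reflect]
  refine Finset.sum_congr rfl fun p hp => ?_
  have hp' : p ≤ n := Nat.lt_succ_iff.1 (Finset.mem_range.1 hp)
  rw [show n + 1 - 1 - p = n - p by omega, Nat.sub_sub_self hp', mul_comm]

theorem mulCoeff_succ (f g : ℕ → ℂ) (n : ℕ) :
    mulCoeff f g (n + 1) = mulCoeff f (fun m => g (m + 1)) n + f (n + 1) * g 0 := by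
  unfold mulCoeff
  rw [Finset.sum_range_succ, Nat.sub_self]
  congr 1
  refine Finset.sum_congr rfl fun p hp => ?_
  rw [Nat.sub_add_comm (Nat.lt_succ_iff.1 (Finset.mem_range.1 hp))]

theorem hasSum_antidiagonal {F : ℕ → ℕ → ℂ} (hF : Summable fun x : ℕ × ℕ => F x.1 x.2) :
    HasSum (fun k => ∑ p ∈ Finset.range (k + 1), F p (k - p)) (∑' p, ∑' q, F p q) := by
  have h1 := (Finset.HasAntidiagonal.sigmaAntidiagonalEquivProd (A := ℕ)).hasSum_iff.2 hF.hasSum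
  rw [hF.tsum_prod] at h1
  refine h1.sigma fun k => ?_
  rw [← Finset.Nat.sum_antidiagonal_eq_sum_range_succ,
    ← Finset.sum_coe_sort (Finset.HasAntidiagonal.antidiagonal k) fun x : ℕ × ℕ => F x.1 x.2]
  exact hasSum_fintype _

theorem summable_prod_of_le {a b h : ℕ → ℂ} (ha : InW a) (hb : InW b) (hh : IsBdd h)
    (f : ℕ → ℕ → ℕ) :
    Summable fun x : ℕ × ℕ => a x.1 * b x.2 * h (f x.1 x.2) := by
  obtain ⟨C, hC⟩ := hh
  refine Summable.of_norm_bounded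
    ((Summable.mul_of_nonneg ha hb (fun _ => norm_nonneg _) (fun _ => norm_nonneg _)).mul_right C)
    fun x => ?_
  rw [norm_mul, norm_mul]
  exact mul_le_mul_of_nonneg_left (hC _) (by positivity)

theorem summable_hankel_prod {u a h : ℕ → ℂ} (hu : InW u) (ha : InW a) (hh : IsBdd h) (n : ℕ) :
    Summable fun x : ℕ × ℕ => u (n + x.1 + x.2) * conj (a x.1) * conj (h x.2) := by
  obtain ⟨C, hC⟩ := hh
  have key : Summable fun x : ℕ × ℕ => ‖a x.1‖ * ‖u (n + x.1 + x.2)‖ := by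
    refine (summable_prod_of_nonneg fun _ => by positivity).2 ⟨fun p => ?_, ?_⟩
    · exact Summable.mul_left ‖a p‖ (hu.comp_injective (add_right_injective (n + p)))
    · refine Summable.of_nonneg_of_le (fun p => tsum_nonneg fun _ => by positivity) (fun p => ?_)
        (ha.mul_right (wienerNorm u))
      change ∑' q, ‖a p‖ * ‖u (n + p + q)‖ ≤ _
      rw [tsum_mul_left]
      exact mul_le_mul_of_nonneg_left (hu.tsum_comp_le (add_right_injective (n + p)))
        (norm_nonneg _)
  refine Summable.of_norm_bounded (key.mul_right C) fun x => ?_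
  rw [norm_mul, norm_mul, RCLike.norm_conj, RCLike.norm_conj, mul_comm ‖u _‖]
  exact mul_le_mul_of_nonneg_left (hC _) (by positivity)

/-- `H_{H_u a}(h) = Π(ā H_u h)`. -/
theorem hankel_hankel_eq_toeplitzConj {u a h : ℕ → ℂ} (hu : InW u) (ha : InW a) (hh : IsBdd h) :
    hankel (hankel u a) h = toeplitzConj a (hankel u h) := by
  funext n
  unfold hankel toeplitzConj
  simp only [← tsum_mul_left, ← tsum_mul_right]
  have hs := summable_hankel_prod hu ha hh n
  have hcomm : ∑' q, ∑' p, u (n + p + q) * conj (a p) * conj (h q) =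
      ∑' p, ∑' q, u (n + p + q) * conj (a p) * conj (h q) :=
    Summable.tsum_comm (f := fun p q => u (n + p + q) * conj (a p) * conj (h q)) hs
  refine (Eq.trans ?_ hcomm).trans ?_
  · exact tsum_congr fun q => tsum_congr fun p => by rw [add_right_comm]
  · exact tsum_congr fun q => tsum_congr fun p => by ring

/-- `H_{H_u a}(h) = H_u(a h)`. -/
theorem hankel_hankel_eq_hankel_mulCoeff {u a h : ℕ → ℂ} (hu : InW u) (ha : InW a)
    (hh : IsBdd h) :
    hankel (hankel u a) h = hankel u (mulCoeff a h) := by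
  rw [hankel_hankel_eq_toeplitzConj hu ha hh]
  funext n
  have hs := summable_hankel_prod hu ha hh n
  have := (hasSum_antidiagonal
    (F := fun p q => u (n + p + q) * conj (a p) * conj (h q)) hs).tsum_eq
  unfold hankel toeplitzConj mulCoeff
  simp only [← tsum_mul_left, map_sum, map_mul, Finset.mul_sum]
  refine Eq.trans ?_ (this.symm.trans ?_)
  · exact tsum_congr fun q => tsum_congr fun p => by ring
  · refine tsum_congr fun k => Finset.sum_congr rfl fun p hp => ?_
    have hp' : p ≤ k := Nat.lt_succ_iff.1 (Finset.mem_range.1 hp)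
    rw [show n + p + (k - p) = n + k by omega, mul_assoc]

/-- `H_{ab}(h) = a H_b(h) + H_a(Π(b̄ h)) - (b | h) a`. -/
theorem hankel_mulCoeff {a b h : ℕ → ℂ} (ha : InW a) (hb : InW b) (hh : IsBdd h) (n : ℕ) :
    hankel (mulCoeff a b) h n = mulCoeff a (hankel b h) n + hankel a (toeplitzConj b h) n
      - a n * conj (∑' p, h p * conj (b p)) := by
  have hsplit : ∀ p, mulCoeff a b (n + p) * conj (h p) =
      ∑ j ∈ Finset.range (n + 1), a j * (b (n - j + p) * conj (h p)) +
        ∑ m ∈ Finset.range p, a (n + 1 + m) * b (p - 1 - m) * conj (h p) := fun p => by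
    unfold mulCoeff
    rw [show n + p + 1 = n + 1 + p by omega, Finset.sum_range_add, add_mul, Finset.sum_mul,
      Finset.sum_mul]
    congr 1
    · refine Finset.sum_congr rfl fun j hj => ?_
      have : j ≤ n := Nat.lt_succ_iff.1 (Finset.mem_range.1 hj)
      rw [show n + p - j = n - j + p by omega, mul_assoc]
    · refine Finset.sum_congr rfl fun m hm => ?_
      rw [show n + p - (n + 1 + m) = p - 1 - m by omega]
  have hs1 : ∀ j ∈ Finset.range (n + 1),
      Summable fun p => a j * (b (n - j + p) * conj (h p)) :=
    fun j _ => (summable_hankel hb hh (n - j)).mul_left _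
  have hF : Summable fun x : ℕ × ℕ => a (n + 1 + x.1) * b x.2 * conj (h (x.1 + 1 + x.2)) :=
    summable_prod_of_le (ha.comp_injective (add_right_injective (n + 1))) hb hh.conj
      fun p q => p + 1 + q
  have hF2 := hasSum_antidiagonal
    (F := fun p q => a (n + 1 + p) * b q * conj (h (p + 1 + q))) hF
  have hreindex : ∀ k, ∑ p ∈ Finset.range (k + 1),
      a (n + 1 + p) * b (k - p) * conj (h (p + 1 + (k - p))) =
      ∑ p ∈ Finset.range (k + 1), a (n + 1 + p) * b (k - p) * conj (h (k + 1)) := fun k => by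
    refine Finset.sum_congr rfl fun p hp => ?_
    have hp' : p ≤ k := Nat.lt_succ_iff.1 (Finset.mem_range.1 hp)
    rw [show p + 1 + (k - p) = k + 1 by omega]
  simp only [hreindex] at hF2
  have hs2 : Summable fun p =>
      ∑ m ∈ Finset.range p, a (n + 1 + m) * b (p - 1 - m) * conj (h p) :=
    (summable_nat_add_iff 1).1 hF2.summable
  have hT : IsBdd (toeplitzConj b h) := isBdd_toeplitzConj hb hh
  have h0 : conj (toeplitzConj b h 0) = conj (∑' p, h p * conj (b p)) := by
    unfold toeplitzConj
    simp only [zero_add, mul_comm]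
  have hrest : ∑' k, ∑ p ∈ Finset.range (k + 1), a (n + 1 + p) * b (k - p) * conj (h (k + 1)) =
      ∑' p, a (n + 1 + p) * conj (toeplitzConj b h (p + 1)) := by
    refine hF2.tsum_eq.trans (tsum_congr fun p => ?_)
    unfold toeplitzConj
    rw [Complex.conj_tsum, ← tsum_mul_left]
    exact tsum_congr fun q => by
      rw [map_mul, Complex.conj_conj, mul_assoc]
  have hH : hankel a (toeplitzConj b h) n = a n * conj (∑' p, h p * conj (b p)) +
      ∑' p, a (n + 1 + p) * conj (toeplitzConj b h (p + 1)) := by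
    unfold hankel
    rw [(summable_hankel ha hT n).tsum_eq_zero_add, h0, add_zero]
    congr 1
    exact tsum_congr fun p => by rw [show n + (p + 1) = n + 1 + p by omega]
  rw [hH, ← hrest]
  conv_lhs => unfold hankel
  rw [tsum_congr hsplit, (summable_sum hs1).tsum_add hs2, Summable.tsum_finsetSum hs1,
    hs2.tsum_eq_zero_add]
  simp only [tsum_mul_left, Finset.range_zero, Finset.sum_empty, zero_add, Nat.add_sub_cancel]
  unfold mulCoeff hankel
  ring

theorem toeplitzConj_apply_zero (a h : ℕ → ℂ) :
    toeplitzConj a h 0 = ∑' p, h p * conj (a p) := by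
  unfold toeplitzConj
  simp only [zero_add, mul_comm]

theorem hankel_apply_zero (u h : ℕ → ℂ) :
    hankel u h 0 = conj (∑' p, h p * conj (u p)) := by
  unfold hankel
  rw [Complex.conj_tsum]
  exact tsum_congr fun p => by rw [map_mul, Complex.conj_conj, zero_add, mul_comm]

theorem mulCoeff_toeplitzConj_shiftedHankel (a u h : ℕ → ℂ) (n : ℕ) :
    mulCoeff a (toeplitzConj a (shiftedHankel u h)) n =
      mulCoeff a (toeplitzConj a (hankel u h)) (n + 1) -
        a (n + 1) * ∑' p, hankel u h p * conj (a p) := by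
  have hT : (fun m => toeplitzConj a (hankel u h) (m + 1)) =
      toeplitzConj a (shiftedHankel u h) := by
    funext m
    exact tsum_congr fun q => by rw [shiftedHankel, add_right_comm]
  rw [mulCoeff_succ, hT, toeplitzConj_apply_zero, add_sub_cancel_right]

/-! ### Sobolev regularity -/

theorem summable_one_add_sq_rpow_neg {r : ℝ} (hr : 1 / 2 < r) :
    Summable fun k : ℕ => ((1 : ℝ) + (k : ℝ) ^ 2) ^ (-r) := by
  refine Summable.of_norm_bounded_eventually_nat (g := fun k : ℕ => (k : ℝ) ^ (-(2 * r)))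
    (Real.summable_nat_rpow.2 (by linarith)) ?_
  filter_upwards [Filter.eventually_gt_atTop 0] with k hk
  have hk' : (0 : ℝ) < k := Nat.cast_pos.2 hk
  rw [Real.norm_of_nonneg (by positivity), show -(2 * r) = 2 * (-r) by ring,
    Real.rpow_mul hk'.le, Real.rpow_two]
  exact Real.rpow_le_rpow_of_nonpos (by positivity) (by linarith) (by linarith)

theorem summable_sq_norm_of_memlp {h : ℕ → ℂ} (hh : Memℓp h 2) : Summable fun p => ‖h p‖ ^ 2 := by
  simpa using hh.summable (by norm_num)

theorem sq_rpow_half_mul_norm (s : ℝ) (u : ℕ → ℂ) (k : ℕ) :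
    (((1 : ℝ) + (k : ℝ) ^ 2) ^ (s / 2) * ‖u k‖) ^ 2 =
      ((1 : ℝ) + (k : ℝ) ^ 2) ^ s * ‖u k‖ ^ 2 := by
  rw [mul_pow, ← Real.rpow_natCast, ← Real.rpow_mul (by positivity)]
  norm_num

theorem InHs.inW {s : ℝ} (hs : 1 < s) {u : ℕ → ℂ} (hu : InHs s u) : InW u := by
  refine Summable.of_nonneg_of_le (fun _ => norm_nonneg _) (fun k => ?_)
    ((summable_one_add_sq_rpow_neg (r := s) (by linarith)).add hu)
  have hb : (0 : ℝ) < 1 + (k : ℝ) ^ 2 := by positivity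
  have h1 : ((1 : ℝ) + (k : ℝ) ^ 2) ^ (-s) * ((1 : ℝ) + (k : ℝ) ^ 2) ^ s = 1 := by
    rw [← Real.rpow_add hb]; simp
  have hx : 0 < ((1 : ℝ) + (k : ℝ) ^ 2) ^ (-s) := Real.rpow_pos_of_pos hb _
  have hy : 0 < ((1 : ℝ) + (k : ℝ) ^ 2) ^ s := Real.rpow_pos_of_pos hb _
  set x := ((1 : ℝ) + (k : ℝ) ^ 2) ^ (-s)
  set z := ((1 : ℝ) + (k : ℝ) ^ 2) ^ s
  have h2 : 0 ≤ z * (‖u k‖ - x) ^ 2 := by positivity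
  nlinarith [norm_nonneg (u k)]

/-- Hankel operators with symbol in `Hˢ`, `s > 1`, map `L²` to the Wiener algebra. -/
theorem InHs.inW_hankel {s : ℝ} (hs : 1 < s) {u h : ℕ → ℂ} (hu : InHs s u) (hh : Memℓp h 2) :
    InW (hankel u h) := by
  have hh2 := summable_sq_norm_of_memlp hh
  set A : ℕ → ℝ := fun k => ((1 : ℝ) + (k : ℝ) ^ 2) ^ (s / 2) * ‖u k‖ with hA
  have hA2 : Summable fun k => A k ^ 2 := hu.congr fun k => (sq_rpow_half_mul_norm s u k).symm
  have hAn : ∀ n, Summable fun p => A (n + p) ^ 2 := fun n =>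
    hA2.comp_injective (add_right_injective n)
  refine Summable.of_nonneg_of_le (fun _ => norm_nonneg _) (fun n => ?_)
    ((summable_one_add_sq_rpow_neg (r := s / 2) (by linarith)).mul_right
      (∑' k, A k ^ 2 + ∑' k, ‖h k‖ ^ 2))
  have hbn : (0 : ℝ) < 1 + (n : ℝ) ^ 2 := by positivity
  have hterm : ∀ p, ‖u (n + p) * conj (h p)‖ ≤
      ((1 : ℝ) + (n : ℝ) ^ 2) ^ (-(s / 2)) * (A (n + p) ^ 2 + ‖h p‖ ^ 2) := fun p => by
    have hb : (0 : ℝ) < 1 + ((n + p : ℕ) : ℝ) ^ 2 := by positivity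
    have hu' : ‖u (n + p)‖ = (1 + ((n + p : ℕ) : ℝ) ^ 2) ^ (-(s / 2)) * A (n + p) := by
      simp only [hA]
      rw [← mul_assoc, ← Real.rpow_add hb]
      simp
    have hle : ((1 : ℝ) + ((n + p : ℕ) : ℝ) ^ 2) ^ (-(s / 2)) ≤
        ((1 : ℝ) + (n : ℝ) ^ 2) ^ (-(s / 2)) := by
      refine Real.rpow_le_rpow_of_nonpos hbn ?_ (by linarith)
      gcongr
      exact Nat.le_add_right n p
    have hA0 : 0 ≤ A (n + p) := by positivity
    rw [norm_mul, RCLike.norm_conj, hu', mul_assoc]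
    refine mul_le_mul hle ?_ (by positivity) (by positivity)
    nlinarith [sq_nonneg (A (n + p) - ‖h p‖), sq_nonneg (A (n + p)), sq_nonneg ‖h p‖]
  have hsum : Summable fun p =>
      ((1 : ℝ) + (n : ℝ) ^ 2) ^ (-(s / 2)) * (A (n + p) ^ 2 + ‖h p‖ ^ 2) :=
    ((hAn n).add hh2).mul_left _
  refine (tsum_of_norm_bounded hsum.hasSum hterm).trans ?_
  rw [tsum_mul_left, (hAn n).tsum_add hh2]
  refine mul_le_mul_of_nonneg_left (add_le_add_left ?_ _) (by positivity)
  exact tsum_comp_le_tsum_of_inj hA2 (fun _ => sq_nonneg _) (add_right_injective n)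

theorem InW.memlp_two {a : ℕ → ℂ} (ha : InW a) : Memℓp a 2 := by
  have h1 : Memℓp a 1 := memℓp_gen (by simpa [InW] using ha)
  exact h1.of_exponent_ge (by norm_num)

theorem IsResolventOne.inW {s y : ℝ} (hs : 1 < s) {u w : ℕ → ℂ} (hu : InHs s u)
    (hw : IsResolventOne y u w) : InW w := by
  have h1 : Summable fun n => ‖(y : ℂ) * hankel u (hankel u w) n‖ := by
    simp only [norm_mul]
    exact Summable.mul_left _ (hu.inW_hankel hs (hu.inW_hankel hs hw.1).memlp_two)
  have h2 : Summable fun n : ℕ => ‖if n = 0 then (1 : ℂ) else 0‖ :=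
    summable_of_ne_finset_zero (s := {0}) fun n hn => by simp_all
  refine Summable.of_nonneg_of_le (fun _ => norm_nonneg _) (fun n => ?_) (h2.add h1)
  rw [eq_sub_of_add_eq (hw.2 n)]
  exact norm_sub_le _ _

/-! ### The commutator identities -/

section Commutator

variable {y : ℝ} {u w h : ℕ → ℂ}

theorem hankel_resolvent (hw : IsResolventOne y u w) (hHv : InW (hankel u (hankel u w)))
    (hh : IsBdd h) (n : ℕ) :
    hankel w h n =
      (if n = 0 then conj (h 0) else 0) - y * hankel (hankel u (hankel u w)) h n := by
  have h1 : ∀ p, w (n + p) * conj (h p) = (if n + p = 0 then 1 else 0) * conj (h p) -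
      y * (hankel u (hankel u w) (n + p) * conj (h p)) := fun p => by
    rw [← hw.2 (n + p)]; ring
  have h2 : Summable fun p => (if n + p = 0 then (1 : ℂ) else 0) * conj (h p) :=
    summable_of_ne_finset_zero (s := {0}) fun p hp => by simp_all
  have h3 : ∑' p, (if n + p = 0 then (1 : ℂ) else 0) * conj (h p) =
      if n = 0 then conj (h 0) else 0 := by
    rw [tsum_eq_single 0 fun p hp => by simp [hp]]
    simp
  conv_lhs => unfold hankel
  rw [tsum_congr h1, h2.tsum_sub ((summable_hankel hHv hh n).mul_left _), h3, tsum_mul_left]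
  rfl

theorem hankel_mulCoeff_resolvent (hw : IsResolventOne y u w) (hu : InW u) (hwW : InW w)
    (hv : InW (hankel u w)) (hHv : InW (hankel u (hankel u w))) (hh : IsBdd h) (n : ℕ) :
    hankel (mulCoeff w (hankel u w)) h n =
      mulCoeff w (toeplitzConj w (hankel u h)) n -
        y * hankel u (mulCoeff (hankel u w) (toeplitzConj (hankel u w) h)) n +
        y * conj (∑' p, h p * conj (hankel u w p)) * hankel u (hankel u w) n := by
  have hT : IsBdd (toeplitzConj (hankel u w) h) := isBdd_toeplitzConj hv hh
  rw [hankel_mulCoeff hwW hv hh, hankel_hankel_eq_toeplitzConj hu hwW hh,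
    hankel_resolvent hw hHv hT, hankel_hankel_eq_hankel_mulCoeff hu hv hT,
    toeplitzConj_apply_zero, eq_sub_of_add_eq (hw.2 n)]
  split_ifs <;> ring

theorem hankel_mulCoeff_resolvent' (hw : IsResolventOne y u w) (hu : InW u) (hwW : InW w)
    (hv : InW (hankel u w)) (hHv : InW (hankel u (hankel u w))) (hh : IsBdd h) (n : ℕ) :
    hankel (mulCoeff w (hankel u w)) h n =
      hankel u (mulCoeff w (toeplitzConj w h)) n -
        y * (mulCoeff (hankel u w) (toeplitzConj (hankel u w) (hankel u h)) n -
          (∑' p, hankel u h p * conj (hankel u w p)) * hankel u w n) := by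
  have hwh : ∀ m, hankel w h m = (if m = 0 then conj (h 0) else 0) -
      y * toeplitzConj (hankel u w) (hankel u h) m := fun m => by
    rw [hankel_resolvent hw hHv hh, hankel_hankel_eq_toeplitzConj hu hv hh]
  have hmul : mulCoeff (hankel u w) (hankel w h) n = hankel u w n * conj (h 0) -
      y * mulCoeff (hankel u w) (toeplitzConj (hankel u w) (hankel u h)) n := by
    rw [mulCoeff_comm _ (hankel w h), mulCoeff_comm _ (toeplitzConj _ _)]
    simp only [mulCoeff, hwh, sub_mul, Finset.sum_sub_distrib, Finset.mul_sum]
    congr 1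
    · rw [Finset.sum_eq_single 0 (fun p _ hp => by simp [hp]) (by simp)]
      simp [mul_comm]
    · exact Finset.sum_congr rfl fun p _ => by ring
  rw [mulCoeff_comm, hankel_mulCoeff hv hwW hh, hmul,
    hankel_hankel_eq_hankel_mulCoeff hu hwW (isBdd_toeplitzConj hwW hh), ← hankel_apply_zero,
    hwh 0, toeplitzConj_apply_zero]
  simp only [if_true]
  ring

theorem hankel_Gop (hu : InW u) (hwW : InW w) (hv : InW (hankel u w)) (hh : IsBdd h) (n : ℕ) :
    hankel u (fun m => -Complex.I * Gop y u w h m) n =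
      Complex.I * (-y * hankel u (mulCoeff w (toeplitzConj w h)) n +
        y ^ 2 * hankel u (mulCoeff (hankel u w) (toeplitzConj (hankel u w) h)) n) := by
  have h1 := summable_hankel hu (isBdd_mulCoeff hwW (isBdd_toeplitzConj hwW hh)) n
  have h2 := summable_hankel hu (isBdd_mulCoeff hv (isBdd_toeplitzConj hv hh)) n
  have h3 := (((h1.hasSum.mul_left (-(y : ℂ))).add (h2.hasSum.mul_left ((y : ℂ) ^ 2))).mul_left
    Complex.I).tsum_eq
  refine Eq.trans (tsum_congr fun p => ?_) h3
  simp only [Gop, map_mul, map_add, map_neg, map_pow, Complex.conj_I, Complex.conj_ofReal]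
  ring

theorem hankel_Fop (hu : InW u) (hwW : InW w) (hv : InW (hankel u w)) (hh : IsBdd h) (n : ℕ) :
    hankel u (fun m => -Complex.I * Fop y u w h m) n =
      Complex.I * (-y * hankel u (mulCoeff w (toeplitzConj w h)) n +
        y ^ 2 * hankel u (mulCoeff (hankel u w) (toeplitzConj (hankel u w) h)) n -
        y ^ 2 * conj (∑' p, h p * conj (hankel u w p)) * hankel u (hankel u w) n) := by
  have h1 := summable_hankel hu (isBdd_mulCoeff hwW (isBdd_toeplitzConj hwW hh)) n
  have h2 := summable_hankel hu (isBdd_mulCoeff hv (isBdd_toeplitzConj hv hh)) n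
  have h3 := summable_hankel hu hv.isBdd n
  have h4 := ((((h1.hasSum.mul_left (-(y : ℂ))).add (h2.hasSum.mul_left ((y : ℂ) ^ 2))).sub
    (h3.hasSum.mul_left ((y : ℂ) ^ 2 * conj (∑' p, h p * conj (hankel u w p))))).mul_left
    Complex.I).tsum_eq
  refine Eq.trans (tsum_congr fun p => ?_) h4
  simp only [Fop, Gop, map_mul, map_add, map_sub, map_neg, map_pow, Complex.conj_I,
    Complex.conj_ofReal]
  ring

theorem hankel_XJ (n : ℕ) :
    hankel (XJ y u w) h n =
      2 * Complex.I * y * hankel (mulCoeff w (hankel u w)) h n := by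
  unfold hankel XJ
  rw [← tsum_mul_left]
  exact tsum_congr fun p => by rw [mul_assoc]; rfl

theorem commutator_Fop_hankel (hw : IsResolventOne y u w) (hu : InW u) (hwW : InW w)
    (hv : InW (hankel u w)) (hHv : InW (hankel u (hankel u w))) (hh : IsBdd h) (n : ℕ) :
    -Complex.I * Fop y u w (hankel u h) n - hankel u (fun m => -Complex.I * Fop y u w h m) n =
      hankel (XJ y u w) h n := by
  have h1 := hankel_mulCoeff_resolvent hw hu hwW hv hHv hh n
  have h2 := hankel_mulCoeff_resolvent' hw hu hwW hv hHv hh n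
  rw [hankel_Fop hu hwW hv hh, hankel_XJ, Fop, Gop]
  linear_combination (-Complex.I * y) * (h1 + h2)

theorem commutator_Gop_shiftedHankel (hw : IsResolventOne y u w) (hu : InW u) (hwW : InW w)
    (hv : InW (hankel u w)) (hHv : InW (hankel u (hankel u w))) (hh : IsBdd h) (n : ℕ) :
    -Complex.I * Gop y u w (shiftedHankel u h) n -
        shiftedHankel u (fun m => -Complex.I * Gop y u w h m) n =
      shiftedHankel (XJ y u w) h n := by
  have h1 := hankel_mulCoeff_resolvent hw hu hwW hv hHv hh (n + 1)
  have h2 := hankel_mulCoeff_resolvent' hw hu hwW hv hHv hh (n + 1)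
  have h3 : w (n + 1) = -(y * hankel u (hankel u w) (n + 1)) := by
    simpa using eq_sub_of_add_eq (hw.2 (n + 1))
  have h4 : ∑' p, hankel u h p * conj (w p) = conj (∑' p, h p * conj (hankel u w p)) := by
    rw [← toeplitzConj_apply_zero, ← hankel_hankel_eq_toeplitzConj hu hwW hh, hankel_apply_zero]
  unfold shiftedHankel
  rw [hankel_Gop hu hwW hv hh, hankel_XJ, Gop]
  change -Complex.I * (-(y : ℂ) * mulCoeff w (toeplitzConj w (shiftedHankel u h)) n + (y : ℂ) ^ 2 *
    mulCoeff (hankel u w) (toeplitzConj (hankel u w) (shiftedHankel u h)) n) - _ = _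
  rw [mulCoeff_toeplitzConj_shiftedHankel, mulCoeff_toeplitzConj_shiftedHankel, h4, h3]
  linear_combination (-Complex.I * y) * (h1 + h2)

end Commutator

/-- Each coefficient of `H_u(h)` is a continuous linear functional of `u`. -/
theorem hasDerivAt_hankel {u : ℝ → Hardy} {t : ℝ} (hu : DifferentiableAt ℝ u t) {u' : ℕ → ℂ}
    (hu' : ∀ n, HasDerivAt (fun τ => coeffs (u τ) n) (u' n) t) {h : ℕ → ℂ} (hh : Memℓp h 2)
    (n : ℕ) :
    HasDerivAt (fun τ => hankel (coeffs (u τ)) h n) (hankel u' h n) t := by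
  have hg : Memℓp (fun k => if k < n then 0 else h (k - n)) 2 := by
    refine memℓp_gen ?_
    rw [← summable_nat_add_iff n]
    simpa using summable_sq_norm_of_memlp hh
  let g : Hardy := ⟨_, hg⟩
  have hgc : ∀ k, g k = if k < n then 0 else h (k - n) := fun _ => rfl
  have hinner : ∀ f : Hardy, inner ℂ g f = hankel (coeffs f) h n := fun f => by
    have hs := lp.summable_inner (𝕜 := ℂ) g f
    rw [lp.inner_eq_tsum, ← hs.sum_add_tsum_nat_add n, Finset.sum_eq_zero, zero_add]
    · refine tsum_congr fun p => ?_
      rw [RCLike.inner_apply, hgc, if_neg (by omega), Nat.add_sub_cancel, add_comm p n]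
      rfl
    · intro k hk
      rw [hgc, if_pos (Finset.mem_range.1 hk), inner_zero_left]
  have hcoeff : coeffs (deriv u t) = u' := funext fun k => by
    have hk := ((lp.evalCLM ℝ (fun _ : ℕ => ℂ) 2 k).hasFDerivAt).comp_hasDerivAt t hu.hasDerivAt
    exact hk.unique (hu' k)
  have := ((innerSL ℂ g).restrictScalars ℝ).hasFDerivAt.comp_hasDerivAt t hu.hasDerivAt
  rw [← hcoeff, ← hinner]
  exact this.congr_of_eventuallyEq (Filter.Eventually.of_forall fun τ => (hinner (u τ)).symm)

/-- **Theorem 5.2, second part (Lax pair for the Szegő hierarchy)**: along a solution of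
`u̇ = X_{J^y}(u)` on a time interval `I`, `dH_u/dt = [B_u^y, H_u]` and `dK_u/dt = [C_u^y, K_u]`,
with `B_u^y = -iF_u^y`, `C_u^y = -iG_u^y` (commutators applied to `h`, coefficientwise). -/
theorem statement15 (s y : ℝ) (hs : 1 < s) (hy : 0 < y) (I : Set ℝ) (hI : IsOpen I)
    (hIconv : Convex ℝ I) (u : ℝ → Hardy) (w : ℝ → ℕ → ℂ)
    (hsol : IsJySolutionOn s y I u w)
    (t : ℝ) (ht : t ∈ I) (h : ℕ → ℂ) (hh : Memℓp h 2) (n : ℕ) :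
    HasDerivAt (fun τ : ℝ => hankel (coeffs (u τ)) h n)
      (-Complex.I * Fop y (coeffs (u t)) (w t) (hankel (coeffs (u t)) h) n
        - hankel (coeffs (u t)) (fun m => -Complex.I * Fop y (coeffs (u t)) (w t) h m) n) t ∧
    HasDerivAt (fun τ : ℝ => shiftedHankel (coeffs (u τ)) h n)
      (-Complex.I * Gop y (coeffs (u t)) (w t) (shiftedHankel (coeffs (u t)) h) n
        - shiftedHankel (coeffs (u t))
            (fun m => -Complex.I * Gop y (coeffs (u t)) (w t) h m) n) t := by
  obtain ⟨hHs, hsmooth, hres, hder⟩ := hsol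
  have hd : DifferentiableAt ℝ u t :=
    (hsmooth.differentiableOn (by simp)).differentiableAt (hI.mem_nhds ht)
  have hw := hres t ht
  have hu := (hHs t ht).inW hs
  have hwW := hw.inW hs (hHs t ht)
  have hv := (hHs t ht).inW_hankel hs hw.1
  have hHv := (hHs t ht).inW_hankel hs hv.memlp_two
  have hb := isBdd_of_memlp hh
  rw [commutator_Fop_hankel hw hu hwW hv hHv hb, commutator_Gop_shiftedHankel hw hu hwW hv hHv hb]
  exact ⟨hasDerivAt_hankel hd (hder t ht) hh n, hasDerivAt_hankel hd (hder t ht) hh (n + 1)⟩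

end
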